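/- Let X be a set, let f, g, h be bijections of X, and let A ⊆ X be a subset such that supp(g) ⊆ A and the four sets A, h(A), f(A), h(f(A)) are pairwise disjoint. Then the iterated commutator w := [h⁻¹, [f⁻¹, g]] (with [a, b] := a⁻¹ ∘ b⁻¹ ∘ a ∘ b) satisfies supp(w) ⊆ A ∪ h(A) ∪ f(A) ∪ h(f(A)), and w(x) = g(x) for all x ∈ A. -/

import Mathlib

/-- If `k` is supported in `B` and `u` displaces `B` from itself, then `u * k⁻¹ * u⁻¹ * k` is
supported in `B ∪ u(B)` and coincides with `k` on `B`. -/
theorem commutator_support_of_disjoint_image {X : Type*} (k u : Equiv.Perm X) (B : Set X)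
    (hk : {x : X | k x ≠ x} ⊆ B) (hd : Disjoint B (⇑u '' B)) :
    {x : X | (u * k⁻¹ * u⁻¹ * k) x ≠ x} ⊆ B ∪ ⇑u '' B ∧
      ∀ x ∈ B, (u * k⁻¹ * u⁻¹ * k) x = k x := by
  have hfix : ∀ y, y ∉ B → k y = y := fun y hy => by
    by_contra hne
    exact hy (hk hne)
  have hmaps : ∀ x ∈ B, k x ∈ B := fun x hx => by
    by_contra hkx
    exact hkx ((k.injective (hfix _ hkx)).symm ▸ hx)
  have hconj : ∀ y, y ∉ ⇑u '' B → (u * k⁻¹ * u⁻¹) y = y := fun y hy => by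
    have hy' : u⁻¹ y ∉ B := fun hmem => hy ⟨u⁻¹ y, hmem, u.apply_symm_apply y⟩
    have hinv : k⁻¹ (u⁻¹ y) = u⁻¹ y := Equiv.Perm.inv_eq_iff_eq.mpr (hfix _ hy').symm
    rw [Equiv.Perm.mul_apply, Equiv.Perm.mul_apply, hinv]
    exact u.apply_symm_apply y
  constructor
  · intro x hx
    by_contra hnot
    rw [Set.mem_union, not_or] at hnot
    refine hx ?_
    rw [Equiv.Perm.mul_apply, hfix x hnot.1, hconj x hnot.2]
  · intro x hx
    rw [Equiv.Perm.mul_apply]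
    exact hconj _ (Set.disjoint_left.mp hd (hmaps x hx))

/-- Let `f, g, h` be bijections of `X` and `A ⊆ X` with `supp g ⊆ A` and
`A, h(A), f(A), h(f(A))` pairwise disjoint.  Then the iterated commutator
`w = [h⁻¹, [f⁻¹, g]]` (with `[a, b] := a⁻¹ ∘ b⁻¹ ∘ a ∘ b`, so
`w = h ∘ c⁻¹ ∘ h⁻¹ ∘ c` for `c = f ∘ g⁻¹ ∘ f⁻¹ ∘ g`) is supported in
`A ∪ h(A) ∪ f(A) ∪ h(f(A))` and coincides with `g` on `A`. -/
theorem iterated_commutator_support {X : Type*} (f g h : Equiv.Perm X)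
    (A : Set X) (hsupp : {x : X | g x ≠ x} ⊆ A)
    (d₁ : A ∩ ⇑h '' A = ∅)
    (d₂ : A ∩ ⇑f '' A = ∅)
    (d₃ : A ∩ ⇑h '' (⇑f '' A) = ∅)
    (d₄ : (⇑h '' A) ∩ ⇑f '' A = ∅)
    (d₅ : (⇑h '' A) ∩ ⇑h '' (⇑f '' A) = ∅)
    (d₆ : (⇑f '' A) ∩ ⇑h '' (⇑f '' A) = ∅) :
    {x : X | (h * (f * g⁻¹ * f⁻¹ * g)⁻¹ * h⁻¹ * (f * g⁻¹ * f⁻¹ * g)) x ≠ x}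
        ⊆ A ∪ ⇑h '' A ∪ ⇑f '' A ∪ ⇑h '' (⇑f '' A) ∧
      ∀ x ∈ A, (h * (f * g⁻¹ * f⁻¹ * g)⁻¹ * h⁻¹ * (f * g⁻¹ * f⁻¹ * g)) x = g x := by
  simp only [← Set.disjoint_iff_inter_eq_empty] at d₁ d₂ d₃ d₄ d₆
  obtain ⟨hc, hcA⟩ := commutator_support_of_disjoint_image g f A hsupp d₂
  have hd : Disjoint (A ∪ ⇑f '' A) (⇑h '' (A ∪ ⇑f '' A)) := by
    rw [Set.image_union, Set.disjoint_union_left, Set.disjoint_union_right,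
      Set.disjoint_union_right]
    exact ⟨⟨d₁, d₃⟩, d₄.symm, d₆⟩
  obtain ⟨hw, hwA⟩ := commutator_support_of_disjoint_image _ h _ hc hd
  refine ⟨hw.trans_eq ?_, fun x hx => (hwA x (Or.inl hx)).trans (hcA x hx)⟩
  rw [Set.image_union, Set.union_union_union_comm, ← Set.union_assoc]
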